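/- arXiv:1401.1466 — 3 statements merged into one kernel-verified Lean document; each statement's English description precedes it below -/
import Mathlib

section
/- N(5168) ≥ 16; that is, there exist 16 mutually orthogonal latin squares of order 5168 = 16 × 17 × 19. -/
/-- A latin square of order `n`: an `n × n` array with entries from an `n`-element
symbol set such that every row and every column contains each symbol exactly once. -/
def IsLatinSquare {n : ℕ} (L : Fin n → Fin n → Fin n) : Prop :=
  (∀ i, Function.Bijective fun j => L i j) ∧ (∀ j, Function.Bijective fun i => L i j)

/-- Two latin squares of order `n` are orthogonal if the `n²` superimposed
ordered pairs of entries are all distinct. -/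
def AreOrthogonal {n : ℕ} (L M : Fin n → Fin n → Fin n) : Prop :=
  Function.Injective fun p : Fin n × Fin n => (L p.1 p.2, M p.1 p.2)

/-- There exist `r` mutually orthogonal latin squares (MOLS) of order `n`. -/
def HasMOLS (n r : ℕ) : Prop :=
  ∃ L : Fin r → Fin n → Fin n → Fin n,
    (∀ s, IsLatinSquare (L s)) ∧ ∀ s t : Fin r, s ≠ t → AreOrthogonal (L s) (L t)

/-- `molsNum n` is `N(n)`, the maximum size of a set of MOLS of order `n`. -/
noncomputable def molsNum (n : ℕ) : ℕ := sSup {r | HasMOLS n r}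

/-- An orthogonal array with `r + 2` columns gives `r` MOLS. -/
theorem hasMOLS_of_oa {n r : ℕ} {R : Type} [Fintype R] (hR : Fintype.card R = n * n)
    (c : Fin (r + 2) → R → Fin n)
    (hc : ∀ a b, a ≠ b → ∀ x y, c a x = c a y → c b x = c b y → x = y) : HasMOLS n r := by
  have hinj : Function.Injective (fun x : R => (c 0 x, c 1 x)) := by
    intro x y h
    have h' := Prod.mk.inj h
    exact hc 0 1 (by simp) x y h'.1 h'.2
  have hbij : Function.Bijective (fun x : R => (c 0 x, c 1 x)) :=
    (Fintype.bijective_iff_injective_and_card _).2 ⟨hinj, by simp [hR]⟩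
  let Q := Equiv.ofBijective _ hbij
  have h0 : ∀ p, c 0 (Q.symm p) = p.1 := fun p => congrArg Prod.fst (Q.apply_symm_apply p)
  have h1 : ∀ p, c 1 (Q.symm p) = p.2 := fun p => congrArg Prod.snd (Q.apply_symm_apply p)
  refine ⟨fun s i j => c s.succ.succ (Q.symm (i, j)), ?_, ?_⟩
  · intro s
    constructor
    · intro i
      apply Function.Injective.bijective_of_finite
      intro j j' h
      have := hc 0 s.succ.succ (Fin.succ_ne_zero _).symm (Q.symm (i, j)) (Q.symm (i, j'))
        (by rw [h0, h0]) h
      have := Q.symm.injective this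
      exact (Prod.mk.inj this).2
    · intro j
      apply Function.Injective.bijective_of_finite
      intro i i' h
      have := hc 1 s.succ.succ (by
        intro h
        rw [← Fin.succ_zero_eq_one] at h
        exact Fin.succ_ne_zero _ (Fin.succ_injective _ h).symm) (Q.symm (i, j)) (Q.symm (i', j))
        (by rw [h1, h1]) h
      have := Q.symm.injective this
      exact (Prod.mk.inj this).1
  · intro s t hst p q h
    have h' := Prod.mk.inj h
    have := hc s.succ.succ t.succ.succ (by simpa using hst) _ _ h'.1 h'.2
    exact Q.symm.injective this

/-- The same with arbitrary index and symbol types. -/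
theorem hasMOLS_of_oa' {n r : ℕ} {R I : Type} [Fintype R] [Fintype I] {X : I → Type}
    [∀ i, Fintype (X i)] (hI : Fintype.card I = r + 2) (hX : ∀ i, Fintype.card (X i) = n)
    (hR : Fintype.card R = n * n) (c : ∀ i, R → X i)
    (hc : ∀ a b, a ≠ b → ∀ x y, c a x = c a y → c b x = c b y → x = y) : HasMOLS n r := by
  let e := (Fintype.equivFinOfCardEq hI).symm
  refine hasMOLS_of_oa hR (fun a x => Fintype.equivFinOfCardEq (hX (e a)) (c (e a) x)) ?_
  intro a b hab x y h1 h2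
  exact hc (e a) (e b) (fun h => hab (e.injective h)) x y
    ((Fintype.equivFinOfCardEq (hX (e a))).injective h1)
    ((Fintype.equivFinOfCardEq (hX (e b))).injective h2)

theorem hasMOLS_le {n r : ℕ} (hn : 2 ≤ n) (h : HasMOLS n r) : r ≤ n := by
  obtain ⟨L, hL, ho⟩ := h
  let z : Fin n := ⟨0, by omega⟩
  let o : Fin n := ⟨1, by omega⟩
  have : ∀ s, ∃ j, L s o j = L s z z := fun s => ((hL s).1 o).2 _
  choose f hf using this
  have hinj : Function.Injective f := by
    intro s t hst
    by_contra hne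
    have h2 := hf t
    rw [← hst] at h2
    have := @ho s t hne (o, f s) (z, z) (Prod.ext (hf s) h2)
    have := congrArg Fin.val (Prod.mk.inj this).1
    simp [o, z] at this
  simpa using Fintype.card_le_of_injective f hinj

section Construction

variable {F A B : Type} [Field F] [Field A] [Field B]

/-- Pairwise independent functionals on `F × F`. -/
def lam : Option F → F → F → F
  | none, s, _ => s
  | some a, s, t => a * s + t

/-- A functional independent of `lam g`. -/
def muf : Option F → F → F → F
  | none, _, t => t
  | some _, s, _ => s

theorem lam_indep {g h : Option F} (hgh : g ≠ h) {s t s' t' : F} (h1 : lam g s t = lam g s' t')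
    (h2 : lam h s t = lam h s' t') : s = s' ∧ t = t' := by
  rcases g with _ | a <;> rcases h with _ | b
  · exact absurd rfl hgh
  · simp only [lam] at h1 h2
    subst h1
    exact ⟨rfl, by simpa using h2⟩
  · simp only [lam] at h1 h2
    subst h2
    exact ⟨rfl, by simpa using h1⟩
  · simp only [lam] at h1 h2
    have hab : a - b ≠ 0 := sub_ne_zero.2 (fun h => hgh (by rw [h]))
    have : s = s' := by
      apply mul_left_cancel₀ hab
      linear_combination h1 - h2
    subst this
    exact ⟨rfl, by simpa using h1⟩

theorem lam_muf {g : Option F} {s t s' t' : F} (h1 : lam g s t = lam g s' t')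
    (h2 : muf g s t = muf g s' t') : s = s' ∧ t = t' := by
  rcases g with _ | a
  · exact ⟨h1, h2⟩
  · simp only [lam, muf] at h1 h2
    subst h2
    exact ⟨rfl, by simpa using h1⟩

/-- The rows (blocks): `m, b` a block of the affine plane over `A`; `s, t` over `F`;
`u, w` over `B`. -/
abbrev Rw (F A B : Type) : Type := Option F × A × F × F × B × B

/-- Shift used in the first inflation. -/
def iot : Option F → F
  | none => 0
  | some a => a

variable (φ : Option F ≃ A) (ψ : F ⊕ Fin 3 ≃ B) (θ : F × F ≃ Fin 253 ⊕ Fin 3)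
  (χ : Option F → B)

/-- Shift used in the second inflation. -/
def lab (g : Option F) : Option F → F → F → B
  | none, s, t => ψ (Sum.inl (muf g s t))
  | some _, s, t => match θ (s, t) with
    | Sum.inl _ => 0
    | Sum.inr j => ψ (Sum.inr j)

/-- The parallel class of a block. -/
def cls : Rw F A B → (Fin 253 × B) ⊕ (B × B)
  | (none, _, _, _, u, w) => Sum.inr (u, w)
  | (some _, _, s, t, u, w) => match θ (s, t) with
    | Sum.inl i => Sum.inl (i, u)
    | Sum.inr _ => Sum.inr (u, w)

/-- The point of group `g` on a block. -/
def pt (g : Option F) : Rw F A B → A × F × B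
  | (m, b, s, t, u, w) =>
    (φ m * φ g + b, lam g s t + iot m, u * χ g + w + lab ψ θ g m s t)

theorem pt_pt (hχ : Function.Injective χ) {g h : Option F} (hgh : g ≠ h) (x y : Rw F A B)
    (h1 : pt φ ψ θ χ g x = pt φ ψ θ χ g y) (h2 : pt φ ψ θ χ h x = pt φ ψ θ χ h y) : x = y := by
  obtain ⟨m, b, s, t, u, w⟩ := x
  obtain ⟨m', b', s', t', u', w'⟩ := y
  simp only [pt, Prod.mk.injEq] at h1 h2
  obtain ⟨a1, a2, a3⟩ := h1
  obtain ⟨b1, b2, b3⟩ := h2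
  have hg : φ g - φ h ≠ 0 := sub_ne_zero.2 (fun e => hgh (φ.injective e))
  have hm : m = m' := by
    apply φ.injective
    apply mul_right_cancel₀ hg
    linear_combination a1 - b1
  subst hm
  have hb : b = b' := by simpa using a1
  subst hb
  obtain ⟨rfl, rfl⟩ := lam_indep hgh (add_right_cancel a2) (add_right_cancel b2)
  have a4 := add_right_cancel a3
  have b4 := add_right_cancel b3
  have hx : χ g - χ h ≠ 0 := sub_ne_zero.2 (fun e => hgh (hχ e))
  have hu : u = u' := by
    apply mul_right_cancel₀ hx
    linear_combination a4 - b4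
  subst hu
  have hw : w = w' := by simpa using a4
  subst hw
  rfl

theorem pt_cls (g : Option F) (x y : Rw F A B)
    (h1 : pt φ ψ θ χ g x = pt φ ψ θ χ g y) (h2 : cls θ x = cls θ y) : x = y := by
  obtain ⟨m, b, s, t, u, w⟩ := x
  obtain ⟨m', b', s', t', u', w'⟩ := y
  simp only [pt, Prod.mk.injEq] at h1
  obtain ⟨a1, a2, a3⟩ := h1
  rcases m with _ | m <;> rcases m' with _ | m'
  · simp only [cls, Sum.inr.injEq, Prod.mk.injEq] at h2
    obtain ⟨rfl, rfl⟩ := h2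
    have hl := add_left_cancel a3
    simp only [lab] at hl
    have hl' := Sum.inl_injective (ψ.injective hl)
    obtain ⟨rfl, rfl⟩ := lam_muf (add_right_cancel a2) hl'
    have hb : b = b' := by simpa using a1
    rw [hb]
  · rcases hq : θ (s', t') with i | j
    · simp [cls, hq] at h2
    · simp only [cls, hq, Sum.inr.injEq, Prod.mk.injEq] at h2
      obtain ⟨rfl, rfl⟩ := h2
      have hl := add_left_cancel a3
      simp [lab, hq] at hl
  · rcases hq : θ (s, t) with i | j
    · simp [cls, hq] at h2
    · simp only [cls, hq, Sum.inr.injEq, Prod.mk.injEq] at h2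
      obtain ⟨rfl, rfl⟩ := h2
      have hl := add_left_cancel a3
      simp [lab, hq] at hl
  · have key : θ (s, t) = θ (s', t') ∧ u = u' := by
      rcases hq : θ (s, t) with i | j <;> rcases hq' : θ (s', t') with i' | j'
      · simp only [cls, hq, hq', Sum.inl.injEq, Prod.mk.injEq] at h2
        exact ⟨by rw [h2.1], h2.2⟩
      · simp [cls, hq, hq'] at h2
      · simp [cls, hq, hq'] at h2
      · simp only [cls, hq, hq', Sum.inr.injEq, Prod.mk.injEq] at h2
        obtain ⟨rfl, rfl⟩ := h2
        have hl := add_left_cancel a3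
        simp only [lab, hq, hq'] at hl
        exact ⟨by rw [Sum.inr_injective (ψ.injective hl)], rfl⟩
    obtain ⟨hst, rfl⟩ := key
    obtain ⟨rfl, rfl⟩ := Prod.mk.inj (θ.injective hst)
    have hm : m = m' := by simpa [iot] using a2
    subst hm
    have hb : b = b' := by simpa using a1
    have hw : w = w' := by simpa using a3
    rw [hb, hw]

/-- Symbol types of the columns. -/
abbrev Sy (F A B : Type) : Option (Option F) → Type
  | none => (Fin 253 × B) ⊕ (B × B)
  | some _ => A × F × B

theorem hasMOLS_of_fields [Fintype F] [Fintype A] [Fintype B] (hF : Fintype.card F = 16)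
    (hA : Fintype.card A = 17) (hB : Fintype.card B = 19) : HasMOLS (16 * 17 * 19) 16 := by
  obtain ⟨φ⟩ : Nonempty (Option F ≃ A) := ⟨Fintype.equivOfCardEq (by simp [hF, hA])⟩
  obtain ⟨ψ⟩ : Nonempty (F ⊕ Fin 3 ≃ B) := ⟨Fintype.equivOfCardEq (by simp [hF, hB])⟩
  obtain ⟨θ⟩ : Nonempty (F × F ≃ Fin 253 ⊕ Fin 3) := ⟨Fintype.equivOfCardEq (by simp [hF])⟩
  obtain ⟨χ⟩ : Nonempty (Option F ↪ B) :=
    Function.Embedding.nonempty_of_card_le (by simp [hF, hB])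
  letI : ∀ i, Fintype (Sy F A B i) := fun i => match i with
    | none => inferInstanceAs (Fintype ((Fin 253 × B) ⊕ (B × B)))
    | some _ => inferInstanceAs (Fintype (A × F × B))
  refine hasMOLS_of_oa' (R := Rw F A B) (I := Option (Option F)) (X := Sy F A B) ?_ ?_ ?_
    (fun i => match i with
      | none => cls θ
      | some g => pt φ ψ θ χ g) ?_
  · simp [hF]
  · rintro (_ | g)
    · change Fintype.card ((Fin 253 × B) ⊕ (B × B)) = _
      simp [hB]
    · change Fintype.card (A × F × B) = _
      simp [hF, hA, hB]
  · simp [hF, hA, hB]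
  · rintro (_ | g) (_ | h) hgh x y h1 h2
    · exact absurd rfl hgh
    · exact pt_cls φ ψ θ χ h x y h2 h1
    · exact pt_cls φ ψ θ χ g x y h1 h2
    · exact pt_pt φ ψ θ χ χ.injective (fun e => hgh (by rw [e])) x y h1 h2

end Construction

theorem molsNum_5168 : 16 ≤ molsNum (16 * 17 * 19) := by
  haveI : Fact (Nat.Prime 2) := ⟨by norm_num⟩
  haveI : Fact (Nat.Prime 17) := ⟨by norm_num⟩
  haveI : Fact (Nat.Prime 19) := ⟨by norm_num⟩
  letI : Fintype (GaloisField 2 4) := Fintype.ofFinite _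
  have hF : Fintype.card (GaloisField 2 4) = 16 := by
    rw [← Nat.card_eq_fintype_card, GaloisField.card 2 4 (by norm_num)]
    norm_num
  have h : HasMOLS (16 * 17 * 19) 16 :=
    hasMOLS_of_fields (F := GaloisField 2 4) (A := ZMod 17) (B := ZMod 19) hF
      (ZMod.card 17) (ZMod.card 19)
  exact le_csSup ⟨16 * 17 * 19, fun r hr => hasMOLS_le (by norm_num) hr⟩ h
end

section
/- N(6800) ≥ 16; that is, there exist 16 mutually orthogonal latin squares of order 6800 = 16 × 17 × 25. -/
/-- Orthogonal array to MOLS. -/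
lemma hasMOLS_of_oa_s13 {n r : ℕ} {β : Type} [Fintype β] (hβ : Fintype.card β = n * n)
    (f : Fin (r + 2) → β → Fin n)
    (hf : ∀ i j, i ≠ j → ∀ b b', f i b = f i b' → f j b = f j b' → b = b') :
    HasMOLS n r := by
  have hbij : Function.Bijective (fun b => (f 0 b, f 1 b)) := by
    rw [Fintype.bijective_iff_injective_and_card]
    refine ⟨?_, by simp [hβ]⟩
    intro b b' h
    simp only [Prod.mk.injEq] at h
    exact hf 0 1 (by simp [Fin.ext_iff]) b b' h.1 h.2
  let E := Equiv.ofBijective _ hbij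
  have h0 : ∀ p, f 0 (E.symm p) = p.1 := fun p => congrArg Prod.fst (E.apply_symm_apply p)
  have h1 : ∀ p, f 1 (E.symm p) = p.2 := fun p => congrArg Prod.snd (E.apply_symm_apply p)
  refine ⟨fun s i j => f s.succ.succ (E.symm (i, j)), ?_, ?_⟩
  · intro s
    refine ⟨fun i => Finite.injective_iff_bijective.1 ?_,
      fun j => Finite.injective_iff_bijective.1 ?_⟩
    · intro j j' h
      have := hf 0 s.succ.succ (Fin.succ_ne_zero _).symm (E.symm (i, j)) (E.symm (i, j'))
        (by rw [h0, h0]) h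
      simpa using this
    · intro i i' h
      have := hf 1 s.succ.succ (by simp [Fin.ext_iff]) (E.symm (i, j)) (E.symm (i', j))
        (by rw [h1, h1]) h
      simpa using this
  · intro s t hst p q h
    simp only [Prod.mk.injEq] at h
    have := hf s.succ.succ t.succ.succ (by simpa using hst) (E.symm p) (E.symm q) h.1 h.2
    simpa using this

lemma bddAbove_hasMOLS {n : ℕ} (hn : 2 ≤ n) : BddAbove {r | HasMOLS n r} := by
  refine ⟨Fintype.card (Fin n → Fin n → Fin n), ?_⟩
  rintro r ⟨L, hL, hO⟩
  have : Function.Injective L := by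
    intro s t hst
    by_contra hne
    have h := hO s t hne
    rw [hst] at h
    let z : Fin n := ⟨0, by omega⟩
    let w : Fin n := ⟨1, by omega⟩
    obtain ⟨j, hj⟩ := ((hL t).1 w).2 (L t z z)
    have h2 : ((z, z) : Fin n × Fin n) = (w, j) := h (by
      simp only at hj
      simp [hj])
    have h3 : z = w := congrArg Prod.fst h2
    simp [z, w, Fin.ext_iff] at h3
  simpa using Fintype.card_le_of_injective L this

/-- A transversal design with `17` groups over a field with `16` elements. -/
lemma exists_td {F : Type} [Field F] [Fintype F] (hF : Fintype.card F = 16) :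
    ∃ t : Fin 17 → F × F → F, ∀ i j, i ≠ j → ∀ T T', t i T = t i T' → t j T = t j T' → T = T' := by
  classical
  have e : Fin 17 ≃ Option F := Fintype.equivOfCardEq (by simp [hF])
  let s : Option F → F × F → F := fun o T => o.elim T.2 (fun x => T.1 + T.2 * x)
  have hs : ∀ i j, i ≠ j → ∀ T T', s i T = s i T' → s j T = s j T' → T = T' := by
    rintro (_ | x) (_ | y) hxy ⟨a, b⟩ ⟨a', b'⟩ h1 h2
    · simp at hxy
    · simp only [s, Option.elim] at h1 h2
      subst h1
      simpa using h2
    · simp only [s, Option.elim] at h1 h2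
      subst h2
      simpa using h1
    · simp only [s, Option.elim] at h1 h2
      have hne : x - y ≠ 0 := sub_ne_zero.2 (by simpa using hxy)
      have hb : b = b' := by
        apply mul_right_cancel₀ hne
        linear_combination h1 - h2
      subst hb
      simpa using h1
  exact ⟨fun j => s (e j), fun i j hij => hs _ _ (by simpa using hij)⟩

/-- The linear part: distinct slopes determine a line. -/
lemma line_inj {E : Type} [Field E] {x y a b a' b' : E} (hxy : x ≠ y)
    (h1 : a + b * x = a' + b' * x) (h2 : a + b * y = a' + b' * y) : a = a' ∧ b = b' := by
  have hne : x - y ≠ 0 := sub_ne_zero.2 hxy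
  have hb : b = b' := by
    apply mul_right_cancel₀ hne
    linear_combination h1 - h2
  subst hb
  exact ⟨by simpa using h1, rfl⟩

/-- The three-factor product construction, with factors `17`, `16`, `25`. -/
lemma hasMOLS_6800 {A F E : Type} [Field A] [Field F] [Field E] [Fintype A] [Fintype F] [Fintype E]
    (hA : Fintype.card A = 17) (hF : Fintype.card F = 16) (hE : Fintype.card E = 25) :
    HasMOLS 6800 16 := by
  classical
  obtain ⟨t, ht⟩ := exists_td hF
  obtain ⟨S, hS⟩ : ∃ S : Finset (F × F), S.card = 9 := by
    obtain ⟨S, -, h⟩ := Finset.exists_subset_card_eq (s := (Finset.univ : Finset (F × F))) (n := 9)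
      (by simp [hF])
    exact ⟨S, h⟩
  have al : Fin 17 ≃ A := Fintype.equivOfCardEq (by simp [hA])
  obtain ⟨la⟩ : Nonempty (Fin 17 ↪ E) := Function.Embedding.nonempty_of_card_le (by simp [hE])
  -- the relabelling of the nonzero slopes
  obtain ⟨ρ, hρ⟩ : ∃ ρ : A → F, ∀ b b', b ≠ 0 → b' ≠ 0 → ρ b = ρ b' → b = b' := by
    have e : {b : A // b ≠ 0} ≃ F := Fintype.equivOfCardEq (by
      rw [Fintype.card_subtype_compl, hA, hF]; simp)
    refine ⟨fun b => if h : b ≠ 0 then e ⟨b, h⟩ else 0, ?_⟩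
    intro b b' hb hb' h
    simpa [hb, hb'] using h
  -- the colours of the flags in the coarse class
  obtain ⟨c, c1, c2, c3⟩ : ∃ c : Fin 17 → A → F × F → E,
      (∀ j b b' T T', T ∈ S → T' ∈ S → b ≠ 0 → b' ≠ 0 → c j b T = c j b' T' → T = T') ∧
      (∀ j T T', c j 0 T = c j 0 T' → t j T = t j T' → T = T') ∧
      (∀ j b T T', b ≠ 0 → T ∈ S → c j 0 T' ≠ c j b T) := by
    have e : F ⊕ S ≃ E := Fintype.equivOfCardEq (by simp [hF, hE, hS])
    refine ⟨fun j b T => if b = 0 then e (Sum.inl (t (j + 1) T)) else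
      if h : T ∈ S then e (Sum.inr ⟨T, h⟩) else 0, ?_, ?_, ?_⟩
    · intro j b b' T T' hT hT' hb hb' h
      simpa [hT, hT', hb, hb'] using h
    · intro j T T' h h'
      have h2 : t (j + 1) T = t (j + 1) T' := by simpa using h
      exact ht j (j + 1) (by simp) T T' h' h2
    · intro j b T T' hb hT h
      simp [hT, hb] at h
  let Y := (E × E) ⊕ ({T : F × F // T ∉ S} × E)
  have eY : Y ≃ Fin 6800 := Fintype.equivOfCardEq (by
    have : Fintype.card {T : F × F // T ∉ S} = 247 := by
      rw [Fintype.card_subtype_compl]; simp [hF, hS]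
    simp [Y, hE, this])
  have eX : A × F × E ≃ Fin 6800 := Fintype.equivOfCardEq (by simp [hA, hF, hE])
  -- blocks: ((a, b), T, d)
  let β := (A × A) × (F × F) × (E × E)
  -- colour, used only inside the coarse class
  let col : Fin 17 → A → F × F → E := fun j b T => if T ∉ S ∧ b ≠ 0 then 0 else c j b T
  let g : Fin 17 → β → A × F × E := fun j x =>
    (x.1.1 + x.1.2 * al j, ρ x.1.2 + t j x.2.1, col j x.1.2 x.2.1 + (x.2.2.1 + x.2.2.2 * la j))
  let ex : β → Y := fun x => if h : x.2.1 ∉ S ∧ x.1.2 ≠ 0 then Sum.inr (⟨x.2.1, h.1⟩, x.2.2.2)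
    else Sum.inl x.2.2
  have hgg : ∀ i j, i ≠ j → ∀ x y, g i x = g i y → g j x = g j y → x = y := by
    rintro i j hij ⟨⟨a, b⟩, T, d, m⟩ ⟨⟨a', b'⟩, T', d', m'⟩ h1 h2
    simp only [g, Prod.mk.injEq] at h1 h2
    obtain ⟨p1, p2, p3⟩ := h1
    obtain ⟨q1, q2, q3⟩ := h2
    obtain ⟨rfl, rfl⟩ := line_inj (al.injective.ne hij) p1 q1
    obtain rfl := ht i j hij T T' (add_left_cancel p2) (add_left_cancel q2)
    obtain ⟨rfl, rfl⟩ := line_inj (la.injective.ne hij) (add_left_cancel p3) (add_left_cancel q3)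
    rfl
  have hge : ∀ j x y, ex x = ex y → g j x = g j y → x = y := by
    rintro j ⟨⟨a, b⟩, T, d, m⟩ ⟨⟨a', b'⟩, T', d', m'⟩ h1 h2
    simp only [g, Prod.mk.injEq] at h2
    obtain ⟨p1, p2, p3⟩ := h2
    by_cases hx : T ∉ S ∧ b ≠ 0 <;> by_cases hy : T' ∉ S ∧ b' ≠ 0
    · simp only [ex, dif_pos hx, dif_pos hy, Sum.inr.injEq, Prod.mk.injEq, Subtype.mk.injEq] at h1
      obtain ⟨rfl, rfl⟩ := h1
      obtain rfl := hρ b b' hx.2 hy.2 (add_right_cancel p2)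
      obtain rfl := add_right_cancel p1
      obtain rfl := add_right_cancel (add_left_cancel p3)
      rfl
    · simp [ex, dif_pos hx, dif_neg hy] at h1
    · simp [ex, dif_neg hx, dif_pos hy] at h1
    · simp only [ex, dif_neg hx, dif_neg hy, Sum.inl.injEq, Prod.mk.injEq] at h1
      obtain ⟨rfl, rfl⟩ := h1
      have p4 := add_right_cancel p3
      simp only [col, if_neg hx, if_neg hy] at p4
      have key : b = b' ∧ T = T' := by
        by_cases hb : b = 0 <;> by_cases hb' : b' = 0
        · subst hb hb'
          exact ⟨rfl, c2 j T T' p4 (add_left_cancel p2)⟩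
        · subst hb
          exact absurd p4 (c3 j b' T' T hb' (by tauto))
        · subst hb'
          exact absurd p4.symm (c3 j b T T' hb (by tauto))
        · have hT := c1 j b b' T T' (by tauto) (by tauto) hb hb' p4
          subst hT
          exact ⟨hρ b b' hb hb' (add_right_cancel p2), rfl⟩
      obtain ⟨rfl, rfl⟩ := key
      obtain rfl := add_right_cancel p1
      rfl
  refine hasMOLS_of_oa_s13 (β := β) (by simp [β, hA, hF, hE])
    (fun i => Fin.cases (motive := fun _ => β → Fin 6800) (fun x => eY (ex x))
      (fun j x => eX (g j x)) i) ?_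
  intro i j
  refine Fin.cases ?_ (fun i => ?_) i <;> refine Fin.cases ?_ (fun j => ?_) j
  · intro h; exact absurd rfl h
  · intro _ x y h1 h2
    exact hge j x y (eY.injective h1) (eX.injective h2)
  · intro _ x y h1 h2
    exact hge i x y (eY.injective h2) (eX.injective h1)
  · intro h x y h1 h2
    exact hgg i j (fun h' => h (by rw [h'])) x y (eX.injective h1) (eX.injective h2)

theorem molsNum_6800 : 16 ≤ molsNum (16 * 17 * 25) := by
  have h : HasMOLS 6800 16 := by
    haveI : Fact (Nat.Prime 2) := ⟨by norm_num⟩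
    haveI : Fact (Nat.Prime 5) := ⟨by norm_num⟩
    haveI : Fact (Nat.Prime 17) := ⟨by norm_num⟩
    haveI : Fintype (GaloisField 2 4) := Fintype.ofFinite _
    haveI : Fintype (GaloisField 5 2) := Fintype.ofFinite _
    refine hasMOLS_6800 (A := ZMod 17) (F := GaloisField 2 4) (E := GaloisField 5 2)
      (ZMod.card 17) ?_ ?_
    · rw [← Nat.card_eq_fintype_card, GaloisField.card 2 4 (by norm_num)]; norm_num
    · rw [← Nat.card_eq_fintype_card, GaloisField.card 5 2 (by norm_num)]; norm_num
  exact le_csSup (bddAbove_hasMOLS (by norm_num)) h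
end

section
/- N(8 × 9 × 13 × 5^10) ≥ 9; that is, there exist 9 mutually orthogonal latin squares of order 936 · 5^10 = 9140625000. -/
section OA
variable {K V W T M : Type}

/-- An orthogonal array (transversal design) of strength two and index one. -/
structure IsOA (B : Set (K → V)) : Prop where
  ex : ∀ a b, a ≠ b → ∀ x y, ∃ f ∈ B, f a = x ∧ f b = y
  uniq : ∀ f ∈ B, ∀ g ∈ B, ∀ a b, a ≠ b → f a = g a → f b = g b → f = g

/-- Columnwise relabelling of an orthogonal array. -/
lemma IsOA.relabel {B : Set (K → V)} (h : IsOA B) (e : K → V ≃ W) :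
    IsOA ((fun f k => e k (f k)) '' B) := by
  constructor
  · intro a b hab x y
    obtain ⟨f, hf, h1, h2⟩ := h.ex a b hab ((e a).symm x) ((e b).symm y)
    exact ⟨_, ⟨f, hf, rfl⟩, by simp [h1], by simp [h2]⟩
  · rintro _ ⟨f, hf, rfl⟩ _ ⟨g, hg, rfl⟩ a b hab h1 h2
    have := h.uniq f hf g hg a b hab ((e a).injective h1) ((e b).injective h2)
    rw [this]

/-- The linear orthogonal array over a commutative ring. -/
lemma linearOA {R : Type} [CommRing R] (c : K → R)
    (hc : ∀ a b, a ≠ b → IsUnit (c a - c b)) :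
    IsOA (Set.range fun (p : R × R) (k : K) => p.1 + c k * p.2) := by
  constructor
  · intro a b hab x y
    obtain ⟨v, hv⟩ := (hc a b hab).exists_right_inv
    refine ⟨_, ⟨(x - c a * (v * (x - y)), v * (x - y)), rfl⟩, by ring, ?_⟩
    show x - c a * (v * (x - y)) + c b * (v * (x - y)) = y
    linear_combination (-(x - y)) * hv
  · rintro _ ⟨⟨x, y⟩, rfl⟩ _ ⟨⟨x', y'⟩, rfl⟩ a b hab h1 h2
    simp only at h1 h2
    have h3 : (c a - c b) * y = (c a - c b) * y' := by linear_combination h1 - h2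
    have h4 := (hc a b hab).mul_left_cancel h3
    subst h4
    have h5 : x = x' := by linear_combination h1
    rw [h5]

/-- Blocks of Wilson's construction. -/
inductive WilsonBlock (P : T → Prop) (B : Set (Option K → T)) (C : Set (K → M))
    (C' : Set (K → Option M)) (D : Set (K → {x // P x})) : (K → (T × M) ⊕ {x // P x}) → Prop
  | one (f : Option K → T) (hf : f ∈ B) (hP : ¬ P (f none)) (g : K → M) (hg : g ∈ C) :
      WilsonBlock P B C C' D (fun k => Sum.inl (f (some k), g k))
  | two (f : Option K → T) (hf : f ∈ B) (hP : P (f none)) (g : K → Option M) (hg : g ∈ C')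
      (hn : ∃ k, g k ≠ none) :
      WilsonBlock P B C C' D
        (fun k => (g k).elim (Sum.inr ⟨f none, hP⟩) (fun i => Sum.inl (f (some k), i)))
  | three (d : K → {x // P x}) (hd : d ∈ D) : WilsonBlock P B C C' D (fun k => Sum.inr (d k))

lemma wilson (P : T → Prop) {B : Set (Option K → T)} {C : Set (K → M)}
    {C' : Set (K → Option M)} {D : Set (K → {x // P x})} (hB : IsOA B) (hC : IsOA C)
    (hC' : IsOA C') (h0 : (fun _ => none) ∈ C') (hD : IsOA D) :
    IsOA {f | WilsonBlock P B C C' D f} := by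
  have key : ∀ g ∈ C', (∃ k, g k ≠ none) → ∀ a b, a ≠ b → g a = none → g b = none → False := by
    rintro g hg ⟨k, hk⟩ a b hab h1 h2
    have := hC'.uniq g hg _ h0 a b hab h1 h2
    exact hk (congrFun this k)
  have sne : ∀ {a b : K}, a ≠ b → (some a : Option K) ≠ some b := by
    intro a b h; simpa using h
  constructor
  · intro a b hab p q
    rcases p with ⟨x, i⟩ | u <;> rcases q with ⟨y, j⟩ | v
    · obtain ⟨f, hf, h1, h2⟩ := hB.ex (some a) (some b) (sne hab) x y
      by_cases hP : P (f none)
      · obtain ⟨g, hg, h3, h4⟩ := hC'.ex a b hab (some i) (some j)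
        exact ⟨_, .two f hf hP g hg ⟨a, by simp [h3]⟩, by simp [h1, h3], by simp [h2, h4]⟩
      · obtain ⟨g, hg, h3, h4⟩ := hC.ex a b hab i j
        exact ⟨_, .one f hf hP g hg, by simp [h1, h3], by simp [h2, h4]⟩
    · obtain ⟨f, hf, h1, h2⟩ := hB.ex (some a) none (by simp) x v.1
      obtain ⟨g, hg, h3, h4⟩ := hC'.ex a b hab (some i) none
      exact ⟨_, .two f hf (h2 ▸ v.2) g hg ⟨a, by simp [h3]⟩, by simp [h1, h3], by simp [h2, h4]⟩
    · obtain ⟨f, hf, h1, h2⟩ := hB.ex (some b) none (by simp) y u.1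
      obtain ⟨g, hg, h3, h4⟩ := hC'.ex a b hab none (some j)
      exact ⟨_, .two f hf (h2 ▸ u.2) g hg ⟨b, by simp [h4]⟩, by simp [h2, h3], by simp [h1, h4]⟩
    · obtain ⟨d, hd, h1, h2⟩ := hD.ex a b hab u v
      exact ⟨_, .three d hd, by simp [h1], by simp [h2]⟩
  · rintro _ (⟨f, hf, hP, g, hg⟩ | ⟨f, hf, hP, g, hg, hn⟩ | ⟨d, hd⟩) _
      (⟨f', hf', hP', g', hg'⟩ | ⟨f', hf', hP', g', hg', hn'⟩ | ⟨d', hd'⟩) a b hab h1 h2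
    · simp only [Sum.inl.injEq, Prod.mk.injEq] at h1 h2
      obtain rfl := hB.uniq f hf f' hf' _ _ (sne hab) h1.1 h2.1
      obtain rfl := hC.uniq g hg g' hg' _ _ hab h1.2 h2.2
      rfl
    · rcases ha' : g' a with _ | i' <;> rcases hb' : g' b with _ | j' <;>
        simp [ha', hb'] at h1 h2
      obtain rfl := hB.uniq f hf f' hf' _ _ (sne hab) h1.1 h2.1
      exact absurd hP' hP
    · simp at h1
    · rcases ha' : g a with _ | i' <;> rcases hb' : g b with _ | j' <;>
        simp [ha', hb'] at h1 h2
      obtain rfl := hB.uniq f hf _ ‹_› _ _ (sne hab) h1.1 h2.1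
      contradiction
    · rcases ha : g a with _ | i <;> rcases hb : g b with _ | j
      · exact (key g hg hn a b hab ha hb).elim
      all_goals
        rcases ha' : g' a with _ | i' <;> rcases hb' : g' b with _ | j' <;>
          simp [ha, hb, ha', hb'] at h1 h2
      · obtain rfl := hB.uniq f hf f' hf' none (some b) (by simp) h1 h2.1
        obtain rfl := hC'.uniq g hg g' hg' a b hab (by rw [ha, ha']) (by rw [hb, hb', h2.2])
        rfl
      · obtain rfl := hB.uniq f hf f' hf' none (some a) (by simp) h2 h1.1
        obtain rfl := hC'.uniq g hg g' hg' a b hab (by rw [ha, ha', h1.2]) (by rw [hb, hb'])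
        rfl
      · obtain rfl := hB.uniq f hf f' hf' (some a) (some b) (sne hab) h1.1 h2.1
        obtain rfl := hC'.uniq g hg g' hg' a b hab (by rw [ha, ha', h1.2]) (by rw [hb, hb', h2.2])
        rfl
    · rcases ha : g a with _ | i <;> rcases hb : g b with _ | j <;> simp [ha, hb] at h1 h2
      exact (key g hg hn a b hab ha hb).elim
    · simp at h1
    · rcases ha : g' a with _ | i <;> rcases hb : g' b with _ | j <;> simp [ha, hb] at h1 h2
      exact (key _ ‹_› ‹_› a b hab ha hb).elim
    · simp only [Sum.inr.injEq] at h1 h2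
      obtain rfl := hD.uniq _ ‹_› _ ‹_› a b hab h1 h2
      rfl

lemma zmodOA [Fintype K] (t : ℕ) (ht : ∀ d, 0 < d → d < Fintype.card K → Nat.Coprime d t) :
    ∃ B : Set (K → ZMod t), IsOA B := by
  refine ⟨_, linearOA (fun k => ((Fintype.equivFin K k : ℕ) : ZMod t)) ?_⟩
  have main : ∀ a b : ℕ, a < b → b < Fintype.card K → IsUnit ((b : ZMod t) - (a : ZMod t)) := by
    intro a b hab hb
    rw [← Nat.cast_sub hab.le, ZMod.isUnit_iff_coprime]
    exact ht _ (by omega) (by omega)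
  intro a b hab
  have hne : (Fintype.equivFin K a : ℕ) ≠ (Fintype.equivFin K b : ℕ) := by
    intro h
    exact hab ((Fintype.equivFin K).injective (Fin.ext h))
  rcases lt_or_gt_of_ne hne with h | h
  · rw [← neg_sub]
    exact (main _ _ h (Fin.isLt _)).neg
  · exact main _ _ h (Fin.isLt _)

lemma fieldOA [Fintype K] (F : Type) [Field F] [Fintype F]
    (h : Fintype.card K ≤ Fintype.card F) : ∃ B : Set (K → F), IsOA B := by
  obtain ⟨c⟩ := Function.Embedding.nonempty_of_card_le h
  refine ⟨_, linearOA c ?_⟩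
  intro a b hab
  exact (sub_ne_zero.2 (fun h => hab (c.injective h))).isUnit

lemma normalizeOA [Nontrivial K] [Nonempty V] {B : Set (K → V)} (hB : IsOA B)
    (e : V ≃ Option M) : ∃ C : Set (K → Option M), IsOA C ∧ (fun _ => none) ∈ C := by
  classical
  obtain ⟨a, b, hab⟩ := exists_pair_ne K
  obtain ⟨v⟩ := ‹Nonempty V›
  obtain ⟨f, hf, -, -⟩ := hB.ex a b hab v v
  refine ⟨_, hB.relabel (fun k => e.trans (Equiv.swap (e (f k)) none)), f, hf, ?_⟩
  funext k
  simp

lemma hasMOLS_of_OA {n r : ℕ} {B : Set (Option (Option (Fin r)) → Fin n)} (hB : IsOA B) :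
    HasMOLS n r := by
  choose F hF h1 h2 using hB.ex none (some none) (by simp)
  have hinj : ∀ (k l : Option (Option (Fin r))), k ≠ l → ∀ i j i' j',
      F i j k = F i' j' k → F i j l = F i' j' l → i = i' ∧ j = j' := by
    intro k l hkl i j i' j' e1 e2
    have := hB.uniq _ (hF i j) _ (hF i' j') k l hkl e1 e2
    exact ⟨by rw [← h1 i j, this, h1], by rw [← h2 i j, this, h2]⟩
  refine ⟨fun s i j => F i j (some (some s)), fun s => ⟨fun i => ?_, fun j => ?_⟩, ?_⟩
  · refine Finite.injective_iff_bijective.1 fun j j' h => ?_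
    exact (hinj none (some (some s)) (by simp) i j i j' (by rw [h1, h1]) h).2
  · refine Finite.injective_iff_bijective.1 fun i i' h => ?_
    exact (hinj (some none) (some (some s)) (by simp) i j i' j (by rw [h2, h2]) h).1
  · rintro s t hst ⟨i, j⟩ ⟨i', j'⟩ h
    simp only [Prod.mk.injEq] at h
    obtain ⟨rfl, rfl⟩ := hinj (some (some s)) (some (some t)) (by simpa using hst) i j i' j' h.1 h.2
    rfl

end OA

lemma bddAbove_mols (n : ℕ) (hn : 2 ≤ n) : BddAbove {r | HasMOLS n r} := by
  refine ⟨Fintype.card (Fin n → Fin n → Fin n), ?_⟩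
  rintro r ⟨L, hL, hO⟩
  have hinj : Function.Injective L := by
    intro s t hst
    by_contra hne
    have ho := hO s t hne
    rw [hst] at ho
    let z : Fin n := ⟨0, by omega⟩
    let o : Fin n := ⟨1, by omega⟩
    obtain ⟨j, hj⟩ := ((hL t).1 o).2 (L t z z)
    have h3 : ((o, j) : Fin n × Fin n) = (z, z) := by
      apply ho
      simp only at hj ⊢
      rw [hj]
    have h4 := congrArg (fun p : Fin n × Fin n => p.1.val) h3
    simp [z, o] at h4
  simpa using Fintype.card_le_of_injective L hinj

/-- Wilson's construction with parameters `m = 31`. -/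
lemma hasMOLS_wilson (n t u : ℕ) (hn : n = t * 31 + u) (hu0 : 0 < u) (hut : u ≤ t)
    (ht : ∀ d, 0 < d → d < 12 → Nat.Coprime d t)
    (hu : ∀ d, 0 < d → d < 11 → Nat.Coprime d u) : HasMOLS n 9 := by
  have : NeZero t := ⟨by omega⟩
  have : NeZero u := ⟨by omega⟩
  have : Fact (Nat.Prime 31) := ⟨by norm_num⟩
  obtain ⟨B, hB⟩ := zmodOA (K := Option (Option (Option (Fin 9)))) t (by simpa using ht)
  obtain ⟨D, hD⟩ := zmodOA (K := Option (Option (Fin 9))) u (by simpa using hu)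
  obtain ⟨C, hC⟩ := fieldOA (K := Option (Option (Fin 9))) (ZMod 31) (by simp [ZMod.card])
  have : Fintype (GaloisField 2 5) := Fintype.ofFinite _
  have hcard : Fintype.card (GaloisField 2 5) = 32 := by
    rw [← Nat.card_eq_fintype_card, GaloisField.card 2 5 (by norm_num)]; norm_num
  obtain ⟨C0, hC0⟩ := fieldOA (K := Option (Option (Fin 9))) (GaloisField 2 5) (by simp [hcard])
  obtain ⟨C', hC', h0⟩ := normalizeOA (M := ZMod 31) hC0
    (Fintype.equivOfCardEq (by rw [hcard, Fintype.card_option, ZMod.card]))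
  obtain ⟨U, -, hU⟩ := Finset.exists_subset_card_eq (s := (Finset.univ : Finset (ZMod t))) (n := u)
    (by rw [Finset.card_univ, ZMod.card]; exact hut)
  have hUc : Fintype.card {x // x ∈ U} = u := by rw [Fintype.card_coe, hU]
  have eU : ZMod u ≃ {x // x ∈ U} := Fintype.equivOfCardEq (by rw [hUc, ZMod.card])
  have hW := wilson (fun x => x ∈ U) hB hC hC' h0 (hD.relabel (fun _ => eU))
  have eV : (ZMod t × ZMod 31) ⊕ {x // x ∈ U} ≃ Fin n := Fintype.equivOfCardEq (by
    rw [Fintype.card_sum, Fintype.card_prod, hUc, ZMod.card, ZMod.card, Fintype.card_fin, hn])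
  exact hasMOLS_of_OA (hW.relabel (fun _ => eV))

theorem molsNum_936_times_5_pow_10 : 9 ≤ molsNum (8 * 9 * 13 * 5 ^ 10) := by
  refine le_csSup (bddAbove_mols _ (by norm_num)) ?_
  refine hasMOLS_wilson _ 294858869 61 (by norm_num) (by norm_num) (by norm_num) ?_ ?_
  · intro d h1 h2
    interval_cases d <;> norm_num
  · intro d h1 h2
    interval_cases d <;> norm_num
end
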